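/- arXiv:1009.0414 — 2 statements merged into one kernel-verified Lean document; each statement's English description precedes it below -/
import Mathlib

section
/- For 1 ≤ j ≤ m ≤ n and integers 0 ≤ b_1 < b_2 < ⋯ < b_j ≤ m−1, the following identity holds in S(V)⊗Λ(V): M_{m;b_1,…,b_j} · L_m^{j−1} = (−1)^{j(j−1)/2} · M_{m;b_1} M_{m;b_2} ⋯ M_{m;b_j}. -/
open scoped TensorProduct
open MvPolynomial Finset

noncomputable section

/-- The symmetric algebra `S(V) = F[x_1,…,x_n]` of the natural module `V = F^n`. -/
abbrev SV (F : Type) [Field F] (n : ℕ) := MvPolynomial (Fin n) F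

/-- The exterior algebra `Λ(V) = E[y_1,…,y_n]`. -/
abbrev LV (F : Type) [Field F] (n : ℕ) := ExteriorAlgebra F (Fin n → F)

/-- `S(V) ⊗ Λ(V)`. -/
abbrev SL (F : Type) [Field F] (n : ℕ) := SV F n ⊗[F] LV F n

/-- the variable `x_{a+1}` (0-indexed `a`), junk value `0` out of range. -/
def xV (F : Type) [Field F] (n a : ℕ) : SV F n :=
  if h : a < n then X ⟨a, h⟩ else 0

/-- the exterior generator `y_{a+1}` (0-indexed `a`). -/
def yV (F : Type) [Field F] (n a : ℕ) : LV F n :=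
  if h : a < n then ExteriorAlgebra.ι F (Pi.single (⟨a, h⟩ : Fin n) (1 : F)) else 0

/-- the product `y_{s_1} ⋯ y_{s_j}` over `S = {s_1 < ⋯ < s_j}` in increasing order. -/
def yProd (F : Type) [Field F] (n : ℕ) (S : Finset ℕ) : LV F n :=
  ((S.sort (· ≤ ·)).map (yV F n)).prod

/-- determinant of the matrix `(x_t^{q^c})` with rows indexed by `c ∈ R` in increasing
order and columns by `t ∈ C` in increasing order; junk value `0` if sizes differ. -/
def subDet (F : Type) [Field F] (q n : ℕ) (R C : Finset ℕ) : SV F n :=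
  if h : C.card = R.card then
    Matrix.det (Matrix.of fun i j : Fin R.card =>
      xV F n (C.orderEmbOfFin h j) ^ q ^ (R.orderEmbOfFin rfl i : ℕ))
  else 0

/-- Mui's element `M_{m;b_1,…,b_j}` where `B = {b_1 < ⋯ < b_j}` (0-indexed `b`'s);
for `B = ∅` this is the Moore determinant `det (x_t^{q^c})`. -/
def MuiM (F : Type) [Field F] (q n m : ℕ) (B : Finset ℕ) : SL F n :=
  ∑ S ∈ (range m).powersetCard B.card,
    ((-1 : F) ^ (B.card * (B.card + 1) / 2 + (∑ s ∈ S, s) + B.card)) •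
      (subDet F q n (range m \ B) (range m \ S) ⊗ₜ[F] yProd F n S)

/-- `∏_{c : F^a} (c_1 x_1 + ⋯ + c_a x_a + x_{t+1})` (0-indexed `t`). -/
def linProd (F : Type) [Field F] [Fintype F] (n a t : ℕ) : SV F n :=
  ∏ c : Fin a → F, ((∑ k : Fin a, MvPolynomial.C (c k) * xV F n k) + xV F n t)

/-- Dickson's `L_m = V_1 V_2 ⋯ V_m`. -/
def Lm (F : Type) [Field F] [Fintype F] (n m : ℕ) : SV F n :=
  ∏ a ∈ range m, linProd F n a a

/-- The property characterizing the Dickson invariants `Q_{m,k}`: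
`Q_{m,k} · L_m = L_{m,k}` in `F[x_1,…,x_m]`. -/
def DicksonProp (F : Type) [Field F] [Fintype F] (q : ℕ)
    (Q : (m : ℕ) → ℕ → SV F m) : Prop :=
  ∀ m k : ℕ, k ≤ m →
    Q m k * Lm F m m = subDet F q m (range (m + 1) \ {k}) (range m)

/-- action of a matrix on `S(V)` by linear substitution: `x_j ↦ ∑_i g_{ij} x_i`. -/
def gAct (F : Type) [Field F] (n : ℕ) (g : Matrix (Fin n) (Fin n) F) :
    SV F n →ₐ[F] SV F n :=
  MvPolynomial.aeval fun j => ∑ i, MvPolynomial.C (g i j) * MvPolynomial.X i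

/-- action of a matrix on `Λ(V)` by linear substitution: `y_j ↦ ∑_i g_{ij} y_i`. -/
def eAct (F : Type) [Field F] (n : ℕ) (g : Matrix (Fin n) (Fin n) F) :
    LV F n →ₐ[F] LV F n :=
  ExteriorAlgebra.map g.mulVecLin

/-- diagonal action of a matrix on `S(V) ⊗ Λ(V)`. -/
def tAct (F : Type) [Field F] (n : ℕ) (g : Matrix (Fin n) (Fin n) F) :
    SL F n →ₐ[F] SL F n :=
  Algebra.TensorProduct.map (gAct F n g) (eAct F n g)

/-- the invariants of a set of matrices on `S(V) ⊗ Λ(V)`, as an `F`-subspace. -/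
def invSL (F : Type) [Field F] (n : ℕ) (P : Set (Matrix (Fin n) (Fin n) F)) :
    Submodule F (SL F n) where
  carrier := {f | ∀ g ∈ P, tAct F n g f = f}
  add_mem' := fun ha hb g hg => by rw [map_add, ha g hg, hb g hg]
  zero_mem' := fun g hg => map_zero _
  smul_mem' := fun c f hf g hg => by rw [map_smul, hf g hg]

/-- the invariants of `S(V) ⊗ Λ(V) ⊗ Det^k`, i.e. elements with
`det(g)^k (g·f) = f` for all `g ∈ P`. -/
def invSLtw (F : Type) [Field F] (n k : ℕ) (P : Set (Matrix (Fin n) (Fin n) F)) :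
    Submodule F (SL F n) where
  carrier := {f | ∀ g ∈ P, g.det ^ k • tAct F n g f = f}
  add_mem' := fun ha hb g hg => by rw [map_add, smul_add, ha g hg, hb g hg]
  zero_mem' := fun g hg => by rw [map_zero, smul_zero]
  smul_mem' := fun c f hf g hg => by rw [map_smul, smul_comm, hf g hg]

/-- the invariants of a set of matrices on `S(V)`, as an `F`-subalgebra. -/
def invS (F : Type) [Field F] (n : ℕ) (P : Set (Matrix (Fin n) (Fin n) F)) :
    Subalgebra F (SV F n) where
  carrier := {f | ∀ g ∈ P, gAct F n g f = f}
  mul_mem' := fun ha hb g hg => by rw [map_mul, ha g hg, hb g hg]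
  one_mem' := fun g hg => map_one _
  add_mem' := fun ha hb g hg => by rw [map_add, ha g hg, hb g hg]
  zero_mem' := fun g hg => map_zero _
  algebraMap_mem' := fun c g hg => (gAct F n g).commutes c

/-- `v_{i,j+1}` (0-indexed `j`) for the composition `I`. -/
def vij (F : Type) [Field F] [Fintype F] (n : ℕ) (I : Composition n)
    (i : Fin I.length) (j : ℕ) : SV F n :=
  linProd F n (I.sizeUpTo i) (I.sizeUpTo i + j)

/-- `θ_i = L_{n_i}(v_{i,1},…,v_{i,n_i})`. -/
def theta (F : Type) [Field F] [Fintype F] (n : ℕ) (I : Composition n)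
    (i : Fin I.length) : SV F n :=
  MvPolynomial.aeval (fun t : Fin (I.blocksFun i) => vij F n I i t)
    (Lm F (I.blocksFun i) (I.blocksFun i))

/-- `q_{i,k} = Q_{n_i,k}(v_{i,1},…,v_{i,n_i})`, given the Dickson polynomials `Q`. -/
def qInv (F : Type) [Field F] [Fintype F] (n : ℕ) (Q : (m : ℕ) → ℕ → SV F m)
    (I : Composition n) (i : Fin I.length) (k : ℕ) : SV F n :=
  MvPolynomial.aeval (fun t : Fin (I.blocksFun i) => vij F n I i t)
    (Q (I.blocksFun i) k)

/-- the index of the block (0-indexed) of the composition `I` containing `a`. -/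
def blkIdx (n : ℕ) (I : Composition n) (a : ℕ) : ℕ :=
  ((range I.length).filter fun i => I.sizeUpTo (i + 1) ≤ a).card

/-- the parabolic subgroup `P_I`: invertible block upper-triangular matrices. -/
def PIset (F : Type) [Field F] (n : ℕ) (I : Composition n) :
    Set (Matrix (Fin n) (Fin n) F) :=
  {g | IsUnit g.det ∧ ∀ a b : Fin n, blkIdx n I b < blkIdx n I a → g a b = 0}

/-- the subgroup `K_I ≤ P_I`: block upper-triangular with all diagonal blocks
of determinant `1`. -/
def KIset (F : Type) [Field F] (n : ℕ) (I : Composition n) :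
    Set (Matrix (Fin n) (Fin n) F) :=
  {g | IsUnit g.det ∧ (∀ a b : Fin n, blkIdx n I b < blkIdx n I a → g a b = 0) ∧
    ∀ i : Fin I.length,
      Matrix.det (Matrix.of fun a b : Fin (I.blocksFun i) =>
        g (I.embedding i a) (I.embedding i b)) = 1}

/-- the unipotent subgroup `U_n` of uni-uppertriangular matrices. -/
def Uset (F : Type) [Field F] (n : ℕ) : Set (Matrix (Fin n) (Fin n) F) :=
  {g | (∀ a b : Fin n, b < a → g a b = 0) ∧ ∀ a : Fin n, g a a = 1}

/-- `SL_n(q)`. -/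
def SLset (F : Type) [Field F] (n : ℕ) : Set (Matrix (Fin n) (Fin n) F) :=
  {g | g.det = 1}

/-- `GL_n(q)`. -/
def GLset (F : Type) [Field F] (n : ℕ) : Set (Matrix (Fin n) (Fin n) F) :=
  {g | IsUnit g.det}

/-- the bigraded piece `S^i(V) ⊗ Λ^j(V)` of `S(V) ⊗ Λ(V)`. -/
def piece (F : Type) [Field F] (n i j : ℕ) : Submodule F (SL F n) :=
  LinearMap.range (TensorProduct.map
    (MvPolynomial.homogeneousSubmodule (Fin n) F i).subtype
    (LinearMap.range (ExteriorAlgebra.ι F (M := Fin n → F)) ^ j).subtype)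

/-- the Hilbert series in `ℤ[s][[t]]` of a bigraded subspace `W` of `S(V) ⊗ Λ(V)`:
the coefficient of `t^i` is `∑_{j=0}^n dim (W ∩ (S^i ⊗ Λ^j)) s^j`. -/
def Hser (F : Type) [Field F] (n : ℕ) (W : Submodule F (SL F n)) :
    PowerSeries (Polynomial ℤ) :=
  PowerSeries.mk fun i => ∑ j ∈ range (n + 1),
    Polynomial.C (Module.finrank F ↥(W ⊓ piece F n i j) : ℤ) * Polynomial.X ^ j

/-- the Hilbert series in `ℤ[[t]]` of a graded subalgebra of `S(V)`. -/
def HserS (F : Type) [Field F] (n : ℕ) (W : Subalgebra F (SV F n)) :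
    PowerSeries ℤ :=
  PowerSeries.mk fun d =>
    (Module.finrank F ↥(Subalgebra.toSubmodule W ⊓ MvPolynomial.homogeneousSubmodule (Fin n) F d) : ℤ)

/-- the index set for Mui-type basis elements attached to the composition `I`:
pairs `(i, B)` with `B = {b_1 < ⋯ < b_j} ⊆ {0,…,m_{i+1}−1}` nonempty and
`max B ≥ m_i` (0-indexed `i`). -/
def Adm (n : ℕ) (I : Composition n) : Finset (Fin I.length × Finset ℕ) :=
  (Finset.univ ×ˢ (range n).powerset).filter fun x =>
    x.2 ⊆ range (I.sizeUpTo ((x.1 : ℕ) + 1)) ∧ x.2.Nonempty ∧ ∃ b ∈ x.2, I.sizeUpTo (x.1 : ℕ) ≤ b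

/-- The matrix `A` with row `b i` replaced by the standard basis vector at `f i`, for all `i`. -/
def replaceRows {R ι κ : Type*} [CommRing R] [DecidableEq ι] (A : Matrix ι ι R) (b f : κ → ι) :
    Matrix ι ι R :=
  Matrix.of fun x y => Function.extend b (fun i => if y = f i then 1 else 0) (A · y) x

theorem replaceRows_apply_self {R ι κ : Type*} [CommRing R] [DecidableEq ι] (A : Matrix ι ι R)
    {b : κ → ι} (hb : Function.Injective b) (f : κ → ι) (i : κ) (y : ι) :
    replaceRows A b f (b i) y = if y = f i then 1 else 0 :=
  hb.extend_apply (fun i => if y = f i then (1 : R) else 0) (A · y) i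

theorem replaceRows_apply_of_notMem {R ι κ : Type*} [CommRing R] [DecidableEq ι]
    (A : Matrix ι ι R) {b : κ → ι} (f : κ → ι) {x : ι} (hx : ¬∃ i, b i = x) (y : ι) :
    replaceRows A b f x y = A x y :=
  Function.extend_apply' (fun i => if y = f i then (1 : R) else 0) (A · y) x hx

/-- Replacing rows by standard basis vectors turns a determinant into a signed minor. -/
theorem det_replaceRows {R : Type*} [CommRing R] {j : ℕ} :
    ∀ {m k : ℕ} (A : Matrix (Fin m) (Fin m) R) {b f : Fin j → Fin m} {r c : Fin k → Fin m},
      StrictMono b → StrictMono f → StrictMono r → StrictMono c →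
      (∀ i, i ∈ Set.range r ↔ i ∉ Set.range b) → (∀ i, i ∈ Set.range c ↔ i ∉ Set.range f) →
      (replaceRows A b f).det =
        (-1) ^ (∑ i, (b i : ℕ) + ∑ i, (f i : ℕ)) * (A.submatrix r c).det := by
  induction j with
  | zero =>
    intro m k A b f r c _ _ hr hc hrb hcf
    have surj_r : Function.Surjective r := fun i => (hrb i).2 (by simp)
    have surj_c : Function.Surjective c := fun i => (hcf i).2 (by simp)
    obtain rfl : k = m := by
      simpa using Fintype.card_of_bijective ⟨hr.injective, surj_r⟩
    have hid : ∀ {g : Fin k → Fin k}, StrictMono g → g = id := fun {g} hg =>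
      (Finset.orderEmbOfFin_unique (s := univ) (by simp) (by simp) hg).trans
        (Finset.orderEmbOfFin_unique (s := univ) (by simp) (by simp) strictMono_id).symm
    rw [hid hr, hid hc]
    have : replaceRows A b f = A := by
      ext i k
      exact replaceRows_apply_of_notMem _ _ (by simp) _
    simp [this]
  | succ j ih =>
    intro m k A b f r c hb hf hr hc hrb hcf
    obtain _ | m := m
    · exact (b 0).elim0
    have lift : ∀ {j k : ℕ} {b : Fin (j + 1) → Fin (m + 1)} {r : Fin k → Fin (m + 1)},
        StrictMono b → StrictMono r → (∀ i, i ∈ Set.range r ↔ i ∉ Set.range b) →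
        ∃ (b' : Fin j → Fin m) (r' : Fin k → Fin m), StrictMono b' ∧ StrictMono r' ∧
          (∀ i, (b (Fin.last j)).succAbove (b' i) = b i.castSucc) ∧
          (∀ i, (b (Fin.last j)).succAbove (r' i) = r i) ∧
          (∀ i, i ∈ Set.range r' ↔ i ∉ Set.range b') ∧
          ∑ i, (b i : ℕ) = ∑ i, (b' i : ℕ) + b (Fin.last j) := by
      intro j k b r hb hr hrb
      have hlt : ∀ i : Fin j, b i.castSucc < b (Fin.last j) := fun i => hb (Fin.castSucc_lt_last i)
      choose b' hb' using fun i : Fin j => Fin.exists_succAbove_eq (hlt i).ne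
      choose r' hr' using fun i : Fin k => Fin.exists_succAbove_eq
        (x := r i) (y := b (Fin.last j)) (fun h => (hrb _).1 ⟨i, rfl⟩ ⟨_, h.symm⟩)
      refine ⟨b', r', fun x y h => ?_, fun x y h => ?_, hb', hr', fun i => ?_, ?_⟩
      · rw [← (Fin.strictMono_succAbove (b (Fin.last j))).lt_iff_lt, hb', hb']
        exact hb (Fin.castSucc_lt_castSucc_iff.2 h)
      · rw [← (Fin.strictMono_succAbove (b (Fin.last j))).lt_iff_lt, hr', hr']
        exact hr h
      · have key := hrb ((b (Fin.last j)).succAbove i)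
        have h1 : (b (Fin.last j)).succAbove i ∈ Set.range r ↔ i ∈ Set.range r' := by
          simp [← hr']
        have h2 : (b (Fin.last j)).succAbove i ∈ Set.range b ↔ i ∈ Set.range b' := by
          simp only [Set.mem_range, Fin.exists_fin_succ', ← hb', Fin.succAbove_right_inj]
          simp [(Fin.succAbove_ne _ _).symm]
        rw [← h1, key, h2]
      · rw [Fin.sum_univ_castSucc]
        congr 1
        refine Finset.sum_congr rfl fun i _ => ?_
        have h := hlt i
        rw [← hb', Fin.succAbove_lt_iff_castSucc_lt] at h
        rw [← hb', Fin.succAbove_of_castSucc_lt _ _ h]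
        rfl
    obtain ⟨b', r', mb, mr, hb', hr', hbr, sb⟩ := lift hb hr hrb
    obtain ⟨f', c', mf, mc, hf', hc', hfc, sf⟩ := lift hf hc hcf
    have hminor : (replaceRows A b f).submatrix
          (b (Fin.last j)).succAbove (f (Fin.last j)).succAbove =
        replaceRows (A.submatrix (b (Fin.last j)).succAbove (f (Fin.last j)).succAbove) b' f' := by
      ext x y
      by_cases hx : ∃ i, b' i = x
      · obtain ⟨i, rfl⟩ := hx
        rw [Matrix.submatrix_apply, hb', replaceRows_apply_self _ hb.injective,
          replaceRows_apply_self _ mb.injective, ← hf']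
        simp
      · have hx' : ¬ ∃ i, b i = (b (Fin.last j)).succAbove x := by
          simp only [Fin.exists_fin_succ', ← hb', Fin.succAbove_right_inj]
          simpa [(Fin.succAbove_ne _ _).symm] using hx
        rw [Matrix.submatrix_apply, replaceRows_apply_of_notMem _ _ hx',
          replaceRows_apply_of_notMem _ _ hx, Matrix.submatrix_apply]
    rw [Matrix.det_succ_row _ (b (Fin.last j)), Finset.sum_eq_single (f (Fin.last j))]
    · rw [hminor, ih _ mb mf mr mc hbr hfc, Matrix.submatrix_submatrix,
        show (b (Fin.last j)).succAbove ∘ r' = r from funext hr',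
        show (f (Fin.last j)).succAbove ∘ c' = c from funext hc', sb, sf,
        replaceRows_apply_self _ hb.injective, if_pos rfl]
      ring
    · intro y _ hy
      rw [replaceRows_apply_self _ hb.injective, if_neg hy]
      ring
    · simp

/-- Jacobi's identity: the minors of the adjugate are complementary minors times a power of the
determinant. -/
theorem det_replaceRows_mul_pow {R ι : Type*} [CommRing R] [IsDomain R] [Fintype ι] [DecidableEq ι]
    (A : Matrix ι ι R) (hA : A.det ≠ 0) {j : ℕ} (hj : 1 ≤ j) {b : Fin j → ι}
    (hb : Function.Injective b) (f : Fin j → ι) :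
    (replaceRows A b f).det * A.det ^ (j - 1) =
      (Matrix.of fun i k => A.adjugate (f i) (b k)).det := by
  classical
  set A' := replaceRows A b f with hA'
  have hin : ∀ i x, (A' * A.adjugate) (b i) x = A.adjugate (f i) x := fun i x => by
    simp [hA', Matrix.mul_apply, replaceRows_apply_self _ hb]
  have hout : ∀ y, (¬ ∃ i, b i = y) → ∀ x,
      (A' * A.adjugate) y x = (A.det • (1 : Matrix ι ι R)) y x := by
    intro y hy x
    rw [← Matrix.mul_adjugate, Matrix.mul_apply, Matrix.mul_apply]
    simp [hA', replaceRows_apply_of_notMem _ _ hy]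
  let e : Fin j ≃ {y // ∃ i, b i = y} := Equiv.ofInjective b hb
  have hcard : Fintype.card {y // ¬ ∃ i, b i = y} = Fintype.card ι - j := by
    rw [Fintype.card_subtype_compl]
    congr 1
    exact (Fintype.card_congr e.symm).trans (Fintype.card_fin j)
  have hjι : j ≤ Fintype.card ι := by simpa using Fintype.card_le_of_injective b hb
  have hdet := Matrix.twoBlockTriangular_det (A' * A.adjugate) (fun y => ∃ i, b i = y) (by
    rintro y hy x ⟨i, rfl⟩
    rw [hout y hy, Matrix.smul_apply, Matrix.one_apply_ne, smul_zero]
    exact fun h => hy ⟨i, h.symm⟩)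
  have h1 : (Matrix.toSquareBlockProp (A' * A.adjugate) (fun y => ∃ i, b i = y)).det =
      (Matrix.of fun i k => A.adjugate (f i) (b k)).det := by
    rw [← Matrix.det_submatrix_equiv_self e]
    congr 1
    ext i k
    exact hin i (b k)
  have h2 : (Matrix.toSquareBlockProp (A' * A.adjugate) (fun y => ¬ ∃ i, b i = y)).det =
      A.det ^ (Fintype.card ι - j) := by
    have : Matrix.toSquareBlockProp (A' * A.adjugate) (fun y => ¬ ∃ i, b i = y) = A.det • 1 := by
      ext y x
      refine (hout y y.2 x).trans ?_
      simp [Matrix.one_apply, Subtype.ext_iff]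
    rw [this, Matrix.det_smul, Matrix.det_one, mul_one, hcard]
  rw [h1, h2, Matrix.det_mul, Matrix.det_adjugate,
    show Fintype.card ι - 1 = (j - 1) + (Fintype.card ι - j) by omega, pow_add, ← mul_assoc] at hdet
  exact mul_right_cancel₀ (pow_ne_zero _ hA) hdet

/-- The Moore determinant as a product of linear forms. -/
theorem det_moore {F R : Type*} [Field F] [Fintype F] [CommRing R] [IsDomain R] [Algebra F R]
    (x : ℕ → R) (m : ℕ) (hx : LinearIndependent F fun i : Fin m => x i) :
    (Matrix.of fun c t : Fin m => x t ^ Fintype.card F ^ (c : ℕ)).det =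
      ∏ a ∈ range m, ∏ d : Fin a → F, (∑ k : Fin a, d k • x k + x a) := by
  classical
  set q := Fintype.card F with hq
  have hq1 : 1 < q := Fintype.one_lt_card
  induction m with
  | zero => simp
  | succ m ih =>
    have hx' : LinearIndependent F fun i : Fin m => x i :=
      hx.comp Fin.castSucc (Fin.castSucc_injective m)
    rw [Finset.prod_range_succ, ← ih hx']
    set D := (Matrix.of fun c t : Fin m => x t ^ q ^ (c : ℕ)).det with hD
    set M : R → Matrix (Fin (m + 1)) (Fin (m + 1)) R := fun z =>
      Matrix.of fun c t => (if t = Fin.last m then z else x t) ^ q ^ (c : ℕ) with hM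
    set a : Fin (m + 1) → R := fun c => (-1) ^ ((c : ℕ) + m) *
      (Matrix.of fun (i : Fin m) (t : Fin m) => x t ^ q ^ (c.succAbove i : ℕ)).det with ha
    set P : Polynomial R := ∑ c, Polynomial.C (a c) * Polynomial.X ^ q ^ (c : ℕ) with hP
    have hPeval : ∀ z, P.eval z = (M z).det := by
      intro z
      rw [Matrix.det_succ_column _ (Fin.last m), hP, Polynomial.eval_finsetSum]
      refine Finset.sum_congr rfl fun c _ => ?_
      have : (M z).submatrix c.succAbove (Fin.last m).succAbove =
          Matrix.of fun (i : Fin m) (t : Fin m) => x t ^ q ^ (c.succAbove i : ℕ) := by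
        ext i t
        simp [hM, (Fin.castSucc_lt_last t).ne]
      rw [this]
      simp only [hM, ha, Polynomial.eval_mul, Polynomial.eval_C, Polynomial.eval_pow,
        Polynomial.eval_X, Matrix.of_apply, if_true, Fin.val_last]
      ring
    have hlin : ∀ d : Fin m → F, P.eval (-∑ k, d k • x k) = 0 := by
      intro d
      have hroot : ∀ k : Fin m, P.eval (x k) = 0 := fun k => by
        rw [hPeval]
        refine Matrix.det_zero_of_column_eq (Fin.castSucc_lt_last k).ne fun c => ?_
        simp [hM, (Fin.castSucc_lt_last k).ne]
      obtain ⟨p, hp⟩ := CharP.exists F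
      obtain ⟨s, hprime, hcard⟩ := FiniteField.card F p
      have : Fact p.Prime := ⟨hprime⟩
      have : CharP R p := charP_of_injective_algebraMap (algebraMap F R).injective p
      have hpow : ∀ c : ℕ, (-∑ k, d k • x k) ^ q ^ c = ∑ k, (-d k) • x k ^ q ^ c := fun c => by
        rw [← Finset.sum_neg_distrib, hq, hcard, ← pow_mul, sum_pow_char_pow]
        refine Finset.sum_congr rfl fun k _ => ?_
        rw [← neg_smul, smul_pow, pow_mul, ← hcard, FiniteField.pow_card_pow]
      calc P.eval (-∑ k, d k • x k) = ∑ c : Fin (m + 1), a c * ∑ k, (-d k) • x k ^ q ^ (c : ℕ) := by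
            rw [hP, Polynomial.eval_finsetSum]
            simp only [Polynomial.eval_mul, Polynomial.eval_C, Polynomial.eval_pow,
              Polynomial.eval_X, hpow]
        _ = ∑ k, (-d k) • P.eval (x k) := by
            simp only [hP, Polynomial.eval_finsetSum, Polynomial.eval_mul, Polynomial.eval_C,
              Polynomial.eval_pow, Polynomial.eval_X, Finset.mul_sum, Finset.smul_sum]
            rw [Finset.sum_comm]
            simp only [mul_smul_comm]
        _ = 0 := by simp [hroot]
    set G : Polynomial R := Polynomial.C D *
      ∏ d : Fin m → F, (Polynomial.X + Polynomial.C (∑ k, d k • x k)) with hG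
    have hPG : P = G := by
      have hcard : #(univ : Finset (Fin m → F)) = q ^ m := by simp [hq]
      refine Polynomial.eq_of_degree_sub_lt_of_eval_index_eq (univ : Finset (Fin m → F))
        (v := fun d => -∑ k : Fin m, d k • x k) ?_ ?_ ?_
      · intro d _ e _ h
        exact LinearIndependent.fintypeLinearCombination_injective hx'
          (by simpa [Fintype.linearCombination_apply] using h)
      · have hmonic : (∏ d : Fin m → F,
            (Polynomial.X + Polynomial.C (∑ k, d k • x k))).Monic :=
          Polynomial.monic_prod_of_monic _ _ fun d _ => Polynomial.monic_X_add_C _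
        have hdeg : (∏ d : Fin m → F,
            (Polynomial.X + Polynomial.C (∑ k, d k • x k))).natDegree = q ^ m := by
          rw [Polynomial.natDegree_prod_of_monic _ _ fun d _ => Polynomial.monic_X_add_C _]
          simp [hq, -map_sum]
        rw [hcard, Polynomial.degree_lt_iff_coeff_zero]
        intro k hk
        have hlast : a (Fin.last m) = D := by
          simp [ha, hD, ← two_mul]
        rw [Polynomial.coeff_sub, sub_eq_zero, hP, Polynomial.finsetSum_coeff,
          Fin.sum_univ_castSucc, hlast, hG, Polynomial.coeff_C_mul, Polynomial.coeff_C_mul,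
          Polynomial.coeff_X_pow, Finset.sum_eq_zero, zero_add]
        · congr 1
          obtain rfl | hk := hk.eq_or_lt
          · rw [← hdeg, hmonic.coeff_natDegree, hdeg, Fin.val_last, if_pos rfl]
          · rw [Polynomial.coeff_eq_zero_of_natDegree_lt (hdeg ▸ hk),
              if_neg (by simpa using hk.ne')]
        · intro c _
          have : q ^ (c : ℕ) < q ^ m := Nat.pow_lt_pow_right hq1 c.2
          rw [Polynomial.coeff_C_mul, Polynomial.coeff_X_pow, if_neg (by simp; omega), mul_zero]
      · intro d _
        rw [hlin, hG, Polynomial.eval_mul, Polynomial.eval_prod,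
          Finset.prod_eq_zero (mem_univ d) (by simp [-map_sum]), mul_zero]
    have hfin := congrArg (Polynomial.eval (x m)) hPG
    rw [hPeval, hG, Polynomial.eval_mul, Polynomial.eval_prod] at hfin
    have hMx : M (x m) = Matrix.of fun c t : Fin (m + 1) => x t ^ q ^ (c : ℕ) := by
      ext c t
      by_cases h : t = Fin.last m <;> simp [hM, h]
    rw [← hMx, hfin]
    simp [add_comm, -map_sum]

theorem sum_mul_self_eq_zero {A ι : Type*} [Ring A] (s : Finset ι) (f : ι → A)
    (hself : ∀ i, f i * f i = 0) (hswap : ∀ i k, f i * f k + f k * f i = 0) :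
    (∑ i ∈ s, f i) * ∑ i ∈ s, f i = 0 := by
  classical
  induction s using Finset.induction_on with
  | empty => simp
  | insert i s hi ih =>
    have hcross : f i * ∑ k ∈ s, f k + (∑ k ∈ s, f k) * f i = 0 := by
      rw [Finset.mul_sum, Finset.sum_mul, ← Finset.sum_add_distrib]
      exact Finset.sum_eq_zero fun k _ => hswap i k
    rw [Finset.sum_insert hi, add_mul, mul_add, mul_add, hself, ih, zero_add, add_zero, hcross]

/-- The Moore matrix `(x_t^{q^c})` with rows `c < m` and columns `t < m`. -/
def mooreMatrix (F : Type) [Field F] (q n m : ℕ) : Matrix (Fin m) (Fin m) (SV F n) :=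
  Matrix.of fun c t => xV F n t ^ q ^ (c : ℕ)

theorem Lm_ne_zero (F : Type) [Field F] [Fintype F] {n m : ℕ} (hmn : m ≤ n) : Lm F n m ≠ 0 := by
  refine Finset.prod_ne_zero_iff.2 fun a ha => Finset.prod_ne_zero_iff.2 fun c _ h => ?_
  have han : a < n := (Finset.mem_range.1 ha).trans_le hmn
  have heval := congrArg (MvPolynomial.eval (Pi.single (⟨a, han⟩ : Fin n) (1 : F))) h
  have hlow : ∀ k : Fin a, MvPolynomial.eval (Pi.single (⟨a, han⟩ : Fin n) (1 : F)) (xV F n k) = 0 := by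
    intro k
    have hk : (k : ℕ) < n := k.2.trans han
    rw [xV, dif_pos hk, MvPolynomial.eval_X, Pi.single_eq_of_ne]
    simp [Fin.ext_iff, k.2.ne]
  have hself : MvPolynomial.eval (Pi.single (⟨a, han⟩ : Fin n) (1 : F)) (xV F n a) = 1 := by
    rw [xV, dif_pos han, MvPolynomial.eval_X, Pi.single_eq_same]
  simp [hlow, hself] at heval

theorem det_mooreMatrix (F : Type) [Field F] [Fintype F] {n m : ℕ} (hmn : m ≤ n) :
    (mooreMatrix F (Fintype.card F) n m).det = Lm F n m := by
  have hx : LinearIndependent F fun i : Fin m => xV F n i := by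
    have : (fun i : Fin m => xV F n i) = (X : Fin n → SV F n) ∘ Fin.castLE hmn := by
      funext i
      exact dif_pos (i.2.trans_le hmn)
    rw [this]
    exact (MvPolynomial.linearIndependent_X (σ := Fin n) (R := F)).comp _ (Fin.castLE_injective hmn)
  refine (det_moore (xV F n) m hx).trans ?_
  simp only [Lm, linProd, MvPolynomial.smul_eq_C_mul]

theorem subDet_eq_det (F : Type) [Field F] (q n : ℕ) {k : ℕ} {R C : Finset ℕ} (hR : R.card = k)
    (hC : C.card = k) :
    subDet F q n R C = (Matrix.of fun i t : Fin k =>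
      xV F n (C.orderEmbOfFin hC t) ^ q ^ (R.orderEmbOfFin hR i : ℕ)).det := by
  subst hR
  exact dif_pos hC

theorem card_image_val {m j : ℕ} {b : Fin j → Fin m} (hb : StrictMono b) :
    (univ.image fun i => (b i : ℕ)).card = j := by
  simpa using Finset.card_image_of_injective univ (f := fun i => (b i : ℕ))
    (Fin.val_injective.comp hb.injective)

theorem subDet_sdiff (F : Type) [Field F] (q n : ℕ) {m j : ℕ} {b f : Fin j → Fin m}
    (hb : StrictMono b) (hf : StrictMono f) :
    subDet F q n (range m \ univ.image fun i => (b i : ℕ)) (range m \ univ.image fun i => (f i : ℕ)) =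
      (-1) ^ (∑ i, (b i : ℕ) + ∑ i, (f i : ℕ)) * (replaceRows (mooreMatrix F q n m) b f).det := by
  have key : ∀ {b : Fin j → Fin m}, StrictMono b → ∃ r : Fin (m - j) → Fin m, StrictMono r ∧
      (∀ i, i ∈ Set.range r ↔ i ∉ Set.range b) ∧
      ∃ h : (range m \ univ.image fun i => (b i : ℕ)).card = m - j,
        ∀ i, (range m \ univ.image fun i => (b i : ℕ)).orderEmbOfFin h i = r i := by
    intro b hb
    have hcard : ((univ.image b)ᶜ).card = m - j := by
      rw [Finset.card_compl, Finset.card_image_of_injective _ hb.injective]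
      simp
    have hcard' : (range m \ univ.image fun i => (b i : ℕ)).card = m - j := by
      rw [Finset.card_sdiff_of_subset, card_image_val hb, Finset.card_range]
      intro y
      simp only [Finset.mem_image, Finset.mem_range]
      rintro ⟨i, _, rfl⟩
      exact (b i).2
    refine ⟨((univ.image b)ᶜ).orderEmbOfFin hcard, OrderEmbedding.strictMono _, fun i => ?_,
      hcard', fun i => ?_⟩
    · rw [Finset.range_orderEmbOfFin]
      simp
    · refine (congrFun (Finset.orderEmbOfFin_unique hcard'
        (f := fun i => (((univ.image b)ᶜ).orderEmbOfFin hcard i : ℕ)) (fun i => ?_)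
        (Fin.val_strictMono.comp (OrderEmbedding.strictMono _))) i).symm
      have := Finset.orderEmbOfFin_mem ((univ.image b)ᶜ) hcard i
      simp only [Finset.mem_compl, Finset.mem_image, Finset.mem_univ, true_and] at this
      simpa [Fin.val_inj] using this
  obtain ⟨r, hr, hrb, hR, hRr⟩ := key hb
  obtain ⟨c, hc, hcf, hC, hCc⟩ := key hf
  rw [subDet_eq_det F q n hR hC, det_replaceRows _ hb hf hr hc hrb hcf, ← mul_assoc, ← pow_add,
    Even.neg_one_pow ⟨_, rfl⟩, one_mul]
  congr 1
  ext i t : 2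
  simp [hRr, hCc, mooreMatrix]

theorem yProd_image (F : Type) [Field F] (n : ℕ) {j : ℕ} {f : Fin j → ℕ} (hf : StrictMono f) :
    yProd F n (univ.image f) = (List.ofFn fun i => yV F n (f i)).prod := by
  have hcard : (univ.image f).card = j := by
    rw [Finset.card_image_of_injective _ hf.injective, Finset.card_univ, Fintype.card_fin]
  have hsort : (univ.image f).sort (· ≤ ·) = List.ofFn f := by
    refine List.ext_getElem (by simp [hcard]) fun i h1 h2 => ?_
    rw [List.getElem_ofFn]
    exact (congrFun (Finset.orderEmbOfFin_unique hcard (f := f) (by simp) hf)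
      ⟨i, List.length_ofFn (f := f) ▸ h2⟩).symm
  rw [yProd, hsort, List.map_ofFn]
  rfl

/-- The product of the exterior generators indexed by the elements of `S` in increasing order. -/
def extGen (F : Type) [Field F] (n : ℕ) {m j : ℕ} (S : Set.powersetCard (Fin m) j) : LV F n :=
  (List.ofFn fun i => yV F n (Set.powersetCard.ofFinEmbEquiv.symm S i)).prod

theorem MuiM_image (F : Type) [Field F] (q n : ℕ) {m j : ℕ} {b : Fin j → Fin m}
    (hb : StrictMono b) :
    MuiM F q n m (univ.image fun i => (b i : ℕ)) =
      ((-1 : F) ^ (j * (j - 1) / 2 + ∑ i, (b i : ℕ))) •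
        ∑ S : Set.powersetCard (Fin m) j,
          (replaceRows (mooreMatrix F q n m) b (Set.powersetCard.ofFinEmbEquiv.symm S)).det ⊗ₜ[F]
            extGen F n S := by
  have hcard : (univ.image fun i => (b i : ℕ)).card = j := card_image_val hb
  rw [MuiM, hcard, Finset.smul_sum]
  symm
  refine Finset.sum_nbij (fun S => S.1.map Fin.valEmbedding) (fun S _ => ?_) ?_ ?_ (fun S _ => ?_)
  · rw [Finset.mem_powersetCard, Finset.card_map]
    refine ⟨fun y hy => ?_, S.2⟩
    obtain ⟨i, _, rfl⟩ := Finset.mem_map.1 hy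
    exact Finset.mem_range.2 i.2
  · intro S _ T _ h
    exact Subtype.ext (Finset.map_injective _ h)
  · intro T hT
    obtain ⟨hTm, hTj⟩ := Finset.mem_powersetCard.1 hT
    have hlt : ∀ y ∈ T, y < m := fun y hy => Finset.mem_range.1 (hTm hy)
    refine ⟨⟨T.attachFin hlt, (Finset.card_attachFin T hlt).trans hTj⟩, by simp, ?_⟩
    exact Finset.map_valEmbedding_attachFin hlt
  · set f := Set.powersetCard.ofFinEmbEquiv.symm S with hf
    have hS : S.1.map Fin.valEmbedding = univ.image fun i => (f i : ℕ) := by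
      have : S.1 = univ.image f := by
        rw [← Finset.coe_inj, Finset.coe_image, Finset.coe_univ, Set.image_univ]
        exact (Finset.range_orderEmbOfFin S.1 S.2).symm
      rw [this, Finset.map_eq_image, Finset.image_image]
      rfl
    have hsum : ∑ s ∈ S.1.map Fin.valEmbedding, s = ∑ i, (f i : ℕ) := by
      rw [hS, Finset.sum_image fun i _ k _ h => f.injective (Fin.val_injective h)]
    have htri : j * (j + 1) / 2 = j * (j - 1) / 2 + j := by
      cases j with
      | zero => rfl
      | succ j =>
        rw [Nat.add_sub_cancel, show (j + 1) * (j + 1 + 1) = (j + 1) * j + 2 * (j + 1) by ring]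
        omega
    have hneg : ∀ (k : ℕ) (d : SV F n), (-1) ^ k * d = ((-1 : F) ^ k) • d := fun k d => by
      rw [MvPolynomial.smul_eq_C_mul]
      simp
    rw [hsum, hS, yProd_image F n (f := fun i => (f i : ℕ))
        (Fin.val_strictMono.comp f.strictMono),
      subDet_sdiff F q n hb f.strictMono, hneg, TensorProduct.smul_tmul',
      TensorProduct.smul_tmul', smul_smul, ← pow_add,
      htri, show j * (j - 1) / 2 + j + ∑ i, (f i : ℕ) + j + (∑ i, (b i : ℕ) + ∑ i, (f i : ℕ)) =
        j * (j - 1) / 2 + ∑ i, (b i : ℕ) + 2 * (j + ∑ i, (f i : ℕ)) by ring, pow_add _ _ (2 * _),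
      pow_mul, neg_one_sq, one_pow, mul_one]
    rfl

theorem prod_ofFn_sum_tmul_yV (F : Type) [Field F] (n : ℕ) {m j : ℕ} (v : Fin j → Fin m → SV F n) :
    (List.ofFn fun i => ∑ s : Fin m, v i s ⊗ₜ[F] yV F n s).prod =
      ∑ S : Set.powersetCard (Fin m) j,
        (Matrix.of fun i k => v i (Set.powersetCard.ofFinEmbEquiv.symm S k)).det ⊗ₜ[F]
          extGen F n S := by
  have hy : ∀ a, ∃ w, yV F n a = ExteriorAlgebra.ι F w := fun a => by
    unfold yV
    split
    · exact ⟨_, rfl⟩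
    · exact ⟨0, (map_zero _).symm⟩
  choose w hw using hy
  let φ : (Fin m → SV F n) →ₗ[SV F n] SL F n :=
    Fintype.linearCombination (SV F n) fun s : Fin m => (1 : SV F n) ⊗ₜ[F] yV F n s
  have hφ : ∀ u, φ u = ∑ s : Fin m, u s ⊗ₜ[F] yV F n s := fun u => by
    simp [φ, Fintype.linearCombination_apply, TensorProduct.smul_tmul']
  have hsq : ∀ u, φ u * φ u = 0 := fun u => by
    rw [hφ]
    refine sum_mul_self_eq_zero _ _ (fun s => ?_) fun s t => ?_
    · rw [Algebra.TensorProduct.tmul_mul_tmul, hw, ExteriorAlgebra.ι_sq_zero,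
        TensorProduct.tmul_zero]
    · rw [Algebra.TensorProduct.tmul_mul_tmul, Algebra.TensorProduct.tmul_mul_tmul,
        mul_comm (u t), ← TensorProduct.tmul_add, hw, hw, ExteriorAlgebra.ι_add_mul_swap,
        TensorProduct.tmul_zero]
  let Φ := ExteriorAlgebra.lift (SV F n) ⟨φ, hsq⟩
  have hΦ : ∀ u : Fin j → Fin m → SV F n,
      Φ (ExteriorAlgebra.ιMulti (SV F n) j u) = (List.ofFn fun i => φ (u i)).prod := fun u => by
    rw [ExteriorAlgebra.ιMulti_apply, map_list_prod, List.map_ofFn]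
    congr 2
    funext i
    exact ExteriorAlgebra.lift_ι_apply _ _ _ _
  have hgen : ∀ S : Set.powersetCard (Fin m) j,
      Φ (exteriorPower.ιMulti_family (SV F n) j (Pi.basisFun (SV F n) (Fin m)) S) =
        (1 : SV F n) ⊗ₜ[F] extGen F n S := fun S => by
    rw [exteriorPower.ιMulti_family, exteriorPower.ιMulti_apply_coe, hΦ]
    have hbasis : ∀ s, φ (Pi.basisFun (SV F n) (Fin m) s) = (1 : SV F n) ⊗ₜ[F] yV F n s :=
      fun s => by simp [φ, Fintype.linearCombination_apply_single]
    simp only [Function.comp_apply, hbasis]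
    rw [extGen, ← Algebra.TensorProduct.includeRight_apply, map_list_prod, List.map_ofFn]
    rfl
  let B := (Pi.basisFun (SV F n) (Fin m)).exteriorPower j
  have hexp := congrArg (fun z : ⋀[SV F n]^j (Fin m → SV F n) => Φ z)
    (B.sum_repr (exteriorPower.ιMulti (SV F n) j v))
  simp only [exteriorPower.ιMulti_apply_coe, hΦ, hφ] at hexp
  rw [← hexp, AddSubmonoidClass.coe_finsetSum, map_sum]
  refine Finset.sum_congr rfl fun S _ => ?_
  rw [Submodule.coe_smul, map_smul, exteriorPower.basis_apply, hgen,
    exteriorPower.basis_repr_apply, exteriorPower.ιMultiDual_apply_ιMulti,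
    TensorProduct.smul_tmul', smul_eq_mul, mul_one]
  rfl

theorem MuiM_singleton (F : Type) [Field F] [Fintype F] {n m : ℕ} (hmn : m ≤ n) (c : Fin m) :
    MuiM F (Fintype.card F) n m {(c : ℕ)} = ((-1 : F) ^ (c : ℕ)) •
      ∑ s : Fin m, (mooreMatrix F (Fintype.card F) n m).adjugate s c ⊗ₜ[F] yV F n s := by
  have hdet : (mooreMatrix F (Fintype.card F) n m).det ≠ 0 :=
    det_mooreMatrix F hmn ▸ Lm_ne_zero F hmn
  have h := MuiM_image F (Fintype.card F) n (b := fun _ : Fin 1 => c) (Subsingleton.strictMono _)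
  simp only [Finset.image_const Finset.univ_nonempty] at h
  rw [h]
  congr 1
  · simp
  refine (Fintype.sum_equiv Set.powersetCard.ofSingleton _ _ fun s => ?_).symm
  have hs : (Set.powersetCard.ofFinEmbEquiv.symm (Set.powersetCard.ofSingleton s) : Fin 1 → Fin m) =
      fun _ => s := by
    funext i
    exact Finset.mem_singleton.1 (Finset.orderEmbOfFin_mem {s} (Finset.card_singleton s) i)
  have hadj := det_replaceRows_mul_pow _ hdet le_rfl (b := fun _ : Fin 1 => c)
    (Function.injective_of_subsingleton _) fun _ => s
  rw [extGen, hs, ← mul_one (replaceRows _ _ _).det, ← pow_zero (mooreMatrix F _ n m).det]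
  erw [hadj]
  simp

/-- **Lemma 2.2** (Mui, Proposition 4.5). For `1 ≤ j ≤ m ≤ n` and
`0 ≤ b_1 < ⋯ < b_j ≤ m−1`:
`M_{m;b_1,…,b_j} · L_m^{j−1} = (−1)^{j(j−1)/2} M_{m;b_1} M_{m;b_2} ⋯ M_{m;b_j}`. -/
theorem mui_product_formula
    (F : Type) [Field F] [Fintype F] (p r q n m j : ℕ)
    (hp : p.Prime) (hr : 0 < r) (hq : q = p ^ r) (hF : Fintype.card F = q)
    (hj : 1 ≤ j) (hjm : j ≤ m) (hmn : m ≤ n)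
    (b : Fin j → ℕ) (hb : StrictMono b) (hbm : ∀ i, b i < m) :
    MuiM F q n m (Finset.image b Finset.univ) *
        (Lm F n m ⊗ₜ[F] (1 : LV F n)) ^ (j - 1)
      = ((-1 : F) ^ (j * (j - 1) / 2)) •
          (List.ofFn fun i : Fin j => MuiM F q n m {b i}).prod := by
  subst hF
  set A := mooreMatrix F (Fintype.card F) n m with hA
  have hdet : A.det = Lm F n m := det_mooreMatrix F hmn
  let b' : Fin j → Fin m := fun i => ⟨b i, hbm i⟩
  have hb' : StrictMono b' := hb
  have hprod := (MultilinearMap.mkPiAlgebraFin F j (SL F n)).map_smul_univ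
    (fun i => (-1 : F) ^ b i) (fun i => ∑ s : Fin m, A.adjugate s (b' i) ⊗ₜ[F] yV F n s)
  simp only [MultilinearMap.mkPiAlgebraFin_apply] at hprod
  have hsingle : ∀ i, MuiM F (Fintype.card F) n m {b i} =
      ((-1 : F) ^ b i) • ∑ s : Fin m, A.adjugate s (b' i) ⊗ₜ[F] yV F n s :=
    fun i => MuiM_singleton F hmn (b' i)
  simp only [hsingle]
  rw [hprod, prod_ofFn_sum_tmul_yV, Finset.prod_pow_eq_pow_sum, smul_smul, ← pow_add]
  refine (congrArg (· * _) (MuiM_image F (Fintype.card F) n hb')).trans ?_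
  rw [smul_mul_assoc, Finset.sum_mul]
  congr 1
  refine Finset.sum_congr rfl fun S _ => ?_
  rw [Algebra.TensorProduct.tmul_pow, one_pow, Algebra.TensorProduct.tmul_mul_tmul, mul_one,
    ← hdet, det_replaceRows_mul_pow A (hdet ▸ Lm_ne_zero F hmn) hj hb'.injective,
    ← Matrix.det_transpose]
  rfl

end
end

section
/- Suppose 1 ≤ j ≤ m ≤ n and 0 ≤ b_1 < ⋯ < b_j ≤ m−1. Then there exist polynomials h_{c_1,…,c_j} ∈ S(V)^{U_n(q)}, indexed by the integer sequences 0 ≤ c_1 < ⋯ < c_j ≤ n−1 satisfying (c_1,…,c_j) > (b_j−j+1, b_j−j+2, …, b_j), such that M_{m;b_1,…,b_j} · V_{m+1}V_{m+2}⋯V_n = M_{n;b_1,…,b_j} + ∑_{(c_1,…,c_j)} M_{n;c_1,…,c_j} · h_{c_1,…,c_j}. -/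
open scoped TensorProduct
open MvPolynomial Finset

noncomputable section

/-- `∏_{c : F^m} (c_1 x_1 + ⋯ + c_m x_m + Y)`, whose value at `Y = x_{t+1}` is `linProd F n m t`. -/
def subspaceProd (F : Type) [Field F] [Fintype F] (n m : ℕ) (Y : SV F n) : SV F n :=
  ∏ c : Fin m → F, ((∑ k : Fin m, MvPolynomial.C (c k) * xV F n k) + Y)

theorem prod_add_algebraMap {F K : Type*} [Field F] [Fintype F] [CommRing K] [Algebra F K] (z : K) :
    ∏ d : F, (algebraMap F K d + z) = z ^ Fintype.card F - z := by
  classical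
  have hmonic : (Polynomial.X ^ Fintype.card F - Polynomial.X : Polynomial F).Monic :=
    Polynomial.monic_X_pow_sub (by simpa using Fintype.one_lt_card)
  have hroots := FiniteField.roots_X_pow_card_sub_X F
  have hdeg := FiniteField.X_pow_card_sub_X_natDegree_eq F (Fintype.one_lt_card (α := F))
  have h := Polynomial.prod_multiset_X_sub_C_of_monic_of_roots_card_eq hmonic
    (by rw [hroots, hdeg]; rfl)
  rw [hroots] at h
  have h' := congrArg (Polynomial.aeval z) h
  change Polynomial.aeval z (∏ d : F, (Polynomial.X - Polynomial.C d)) = _ at h'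
  simp only [map_prod, map_sub, Polynomial.aeval_X, Polynomial.aeval_C, map_pow] at h'
  rw [← h']
  refine Fintype.prod_equiv (Equiv.neg F) _ _ fun d => ?_
  simp only [Equiv.neg_apply, map_neg]
  ring

theorem prod_algebraMap_mul_add {F R : Type*} [Field F] [Fintype F] [CommRing R] [IsDomain R]
    [Algebra F R] (v Y : R) :
    ∏ d : F, (algebraMap F R d * v + Y)
      = Y ^ Fintype.card F - v ^ (Fintype.card F - 1) * Y := by
  have hcard := Fintype.one_lt_card (α := F)
  by_cases hv : v = 0
  · subst hv
    simp [zero_pow (Nat.sub_ne_zero_of_lt hcard)]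
  · apply IsFractionRing.injective R (FractionRing R)
    set w := algebraMap R (FractionRing R) v with hw
    have hw0 : w ≠ 0 := by
      rw [hw, Ne, FaithfulSMul.algebraMap_eq_zero_iff]
      exact hv
    set y := algebraMap R (FractionRing R) Y with hy
    have key : ∀ d : F, algebraMap R (FractionRing R) (algebraMap F R d * v + Y)
        = w * (algebraMap F (FractionRing R) d + y / w) := by
      intro d
      rw [map_add, map_mul, ← IsScalarTower.algebraMap_apply, ← hw, ← hy]
      field_simp
    rw [map_prod, Finset.prod_congr rfl fun d _ => key d, Finset.prod_mul_distrib,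
      prod_add_algebraMap, Finset.prod_const, Finset.card_univ, map_sub, map_mul, map_pow, map_pow,
      ← hw, ← hy, mul_sub, div_pow]
    congr 1
    · field_simp
    · obtain ⟨k, hk⟩ : ∃ k, Fintype.card F = k + 1 := ⟨Fintype.card F - 1, by omega⟩
      rw [hk, Nat.add_sub_cancel]
      field_simp
      ring

theorem subspaceProd_xV (F : Type) [Field F] [Fintype F] (n m t : ℕ) :
    subspaceProd F n m (xV F n t) = linProd F n m t := rfl

theorem subspaceProd_xV_eq_zero (F : Type) [Field F] [Fintype F] (n : ℕ) {m t : ℕ} (ht : t < m) :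
    subspaceProd F n m (xV F n t) = 0 := by
  classical
  refine Finset.prod_eq_zero (Finset.mem_univ (fun k => if k = (⟨t, ht⟩ : Fin m) then -1 else 0)) ?_
  rw [Finset.sum_eq_single (⟨t, ht⟩ : Fin m)]
  · simp
  · intro k _ hk
    simp [hk]
  · simp

theorem subspaceProd_zero (F : Type) [Field F] [Fintype F] (n : ℕ) (Y : SV F n) :
    subspaceProd F n 0 Y = Y := by
  simp [subspaceProd]

theorem subspaceProd_succ (F : Type) [Field F] [Fintype F] (n m : ℕ) (Y : SV F n) :
    subspaceProd F n (m + 1) Y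
      = ∏ d : F, subspaceProd F n m (MvPolynomial.C d * xV F n m + Y) := by
  unfold subspaceProd
  rw [← (Fin.snocEquiv fun _ : Fin (m + 1) => F).prod_comp, Fintype.prod_prod_type]
  refine Finset.prod_congr rfl fun d _ => Finset.prod_congr rfl fun c _ => ?_
  simp [Fin.sum_univ_castSucc, Fin.snocEquiv, add_assoc]

/-- `X ↦ ∑_b a_b X^{q^b}` is additive when `q` is a power of the characteristic. -/
theorem linearized_add {R : Type*} [CommRing R] {p q r : ℕ} [ExpChar R p] (hq : q = p ^ r)
    (s : Finset ℕ) (a : ℕ → R) (X Y : R) :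
    ∑ b ∈ s, a b * (X + Y) ^ q ^ b = ∑ b ∈ s, a b * X ^ q ^ b + ∑ b ∈ s, a b * Y ^ q ^ b := by
  rw [← Finset.sum_add_distrib]
  refine Finset.sum_congr rfl fun b _ => ?_
  rw [hq, ← pow_mul, add_pow_expChar_pow, mul_add]

theorem linearized_C_mul {F : Type} [Field F] [Fintype F] {q n : ℕ} (hF : Fintype.card F = q)
    (s : Finset ℕ) (a : ℕ → SV F n) (d : F) (Y : SV F n) :
    ∑ b ∈ s, a b * (MvPolynomial.C d * Y) ^ q ^ b
      = MvPolynomial.C d * ∑ b ∈ s, a b * Y ^ q ^ b := by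
  rw [Finset.mul_sum]
  refine Finset.sum_congr rfl fun b _ => ?_
  rw [mul_pow, ← map_pow, ← hF, FiniteField.pow_card_pow]
  ring

theorem linProd_mem_invS {F : Type} [Field F] [Fintype F] {p q r n m : ℕ} [ExpChar F p]
    (hq : q = p ^ r) (hF : Fintype.card F = q) (hmn : m < n) {a : ℕ → SV F n}
    (ha : ∀ b, a b ∈ invS F n (Uset F n))
    (hP : ∀ Y, subspaceProd F n m Y = ∑ b ∈ range (m + 1), a b * Y ^ q ^ b) :
    linProd F n m m ∈ invS F n (Uset F n) := by
  intro g hg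
  have hadd : ∀ Y Z, subspaceProd F n m (Y + Z) = subspaceProd F n m Y + subspaceProd F n m Z := by
    intro Y Z
    rw [hP, hP, hP, linearized_add hq]
  have hC : ∀ d Y, subspaceProd F n m (MvPolynomial.C d * Y)
      = MvPolynomial.C d * subspaceProd F n m Y := by
    intro d Y
    rw [hP, hP, linearized_C_mul hF]
  let φ : SV F n →+ SV F n := AddMonoidHom.mk' (subspaceProd F n m) hadd
  have hact : gAct F n g (linProd F n m m) = subspaceProd F n m (gAct F n g (xV F n m)) := by
    rw [← subspaceProd_xV, hP, hP, map_sum]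
    refine Finset.sum_congr rfl fun b _ => ?_
    rw [map_mul, map_pow, ha b g hg]
  have hx : gAct F n g (xV F n m) = ∑ i : Fin n, MvPolynomial.C (g i ⟨m, hmn⟩) * xV F n i := by
    simp [gAct, xV, hmn]
  rw [hact, hx]
  change φ _ = _
  rw [map_sum, Finset.sum_eq_single (⟨m, hmn⟩ : Fin n)]
  · change subspaceProd F n m _ = _
    rw [hC, hg.2, map_one, one_mul, subspaceProd_xV]
  · intro i _ hi
    change subspaceProd F n m _ = _
    rw [hC]
    rcases lt_or_gt_of_ne (fun h => hi (Fin.ext h) : (i : ℕ) ≠ m) with h | h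
    · rw [subspaceProd_xV_eq_zero F n h, mul_zero]
    · rw [hg.1 i ⟨m, hmn⟩ h, map_zero, zero_mul]
  · simp

theorem exists_linearized_coeff {F : Type} [Field F] [Fintype F] {p q r : ℕ} [ExpChar F p]
    (hq : q = p ^ r) (hF : Fintype.card F = q) (n m : ℕ) (hmn : m ≤ n) :
    ∃ a : ℕ → SV F n, (∀ b, a b ∈ invS F n (Uset F n)) ∧ a m = 1 ∧
      ∀ Y, subspaceProd F n m Y = ∑ b ∈ range (m + 1), a b * Y ^ q ^ b := by
  induction m with
  | zero => exact ⟨fun _ => 1, fun _ => one_mem _, rfl, fun Y => by simp [subspaceProd_zero]⟩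
  | succ m ih =>
    obtain ⟨a, ha, ha1, hP⟩ := ih (by omega)
    have hv := linProd_mem_invS hq hF hmn ha hP
    set v := linProd F n m m with hv_def
    have hrec : ∀ Y, subspaceProd F n (m + 1) Y
        = subspaceProd F n m Y ^ q - v ^ (q - 1) * subspaceProd F n m Y := by
      intro Y
      rw [subspaceProd_succ, ← hF, ← prod_algebraMap_mul_add]
      refine Finset.prod_congr rfl fun d _ => ?_
      rw [hP, linearized_add hq, linearized_C_mul hF, ← hP, ← hP, subspaceProd_xV,
        MvPolynomial.algebraMap_eq]
    refine ⟨fun b => (if b = 0 then 0 else a (b - 1) ^ q) -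
      (if b = m + 1 then 0 else v ^ (q - 1) * a b), fun b => ?_, ?_, fun Y => ?_⟩
    · refine sub_mem ?_ ?_
      · split_ifs
        · exact zero_mem _
        · exact pow_mem (ha _) _
      · split_ifs
        · exact zero_mem _
        · exact mul_mem (pow_mem hv _) (ha _)
    · simp [ha1]
    · rw [hrec, hP]
      simp only [sub_mul, Finset.sum_sub_distrib]
      congr 1
      · rw [Finset.sum_range_succ' _ (m + 1)]
        simp only [Nat.add_eq_zero_iff, one_ne_zero, and_false, if_false, Nat.add_sub_cancel,
          if_true, zero_mul, add_zero]
        rw [hq, sum_pow_char_pow]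
        refine Finset.sum_congr rfl fun b _ => ?_
        rw [mul_pow, ← pow_mul, ← pow_succ]
      · rw [Finset.sum_range_succ _ (m + 1), if_pos rfl, zero_mul, add_zero, Finset.mul_sum]
        refine Finset.sum_congr rfl fun b hb => ?_
        rw [if_neg (by rw [Finset.mem_range] at hb; omega), mul_assoc]

theorem orderEmbOfFin_insert_eq_snoc {C : Finset ℕ} {k m : ℕ} (hC : C.card = k)
    (hm : ∀ c ∈ C, c < m) (h : (insert m C).card = k + 1) :
    ((insert m C).orderEmbOfFin h : Fin (k + 1) → ℕ)
      = Fin.snoc (α := fun _ => ℕ) (C.orderEmbOfFin hC) m := by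
  refine (Finset.orderEmbOfFin_unique h (fun i => ?_) (fun i j => ?_)).symm
  · refine Fin.lastCases ?_ (fun i => ?_) i
    · simp
    · simp [Finset.orderEmbOfFin_mem]
  · refine Fin.lastCases ?_ (fun j => ?_) j
    · refine Fin.lastCases ?_ (fun i => ?_) i
      · simp
      · intro _
        simpa using hm _ (Finset.orderEmbOfFin_mem _ _ _)
    · refine Fin.lastCases (fun hij => ?_) (fun i => ?_) i
      · exact absurd hij (not_lt.mpr (Fin.le_last _))
      · simp

theorem orderEmbOfFin_insert_castSucc {C : Finset ℕ} {k m : ℕ} (hC : C.card = k)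
    (hm : ∀ c ∈ C, c < m) (h : (insert m C).card = k + 1) (i : Fin k) :
    (insert m C).orderEmbOfFin h i.castSucc = C.orderEmbOfFin hC i := by
  rw [orderEmbOfFin_insert_eq_snoc hC hm]
  simp

theorem orderEmbOfFin_insert_last {C : Finset ℕ} {k m : ℕ} (hC : C.card = k)
    (hm : ∀ c ∈ C, c < m) (h : (insert m C).card = k + 1) :
    (insert m C).orderEmbOfFin h (Fin.last k) = m := by
  rw [orderEmbOfFin_insert_eq_snoc hC hm]
  simp

/-- The matrix `(x_t^{q^{e i}})` with columns `t ∈ C` in increasing order. -/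
def powMatrix (F : Type) [Field F] (q n : ℕ) {k : ℕ} (e : Fin k → ℕ) (C : Finset ℕ)
    (hC : C.card = k) : Matrix (Fin k) (Fin k) (SV F n) :=
  Matrix.of fun i j => xV F n (C.orderEmbOfFin hC j) ^ q ^ e i

theorem subDet_eq_det_powMatrix (F : Type) [Field F] (q n : ℕ) {k : ℕ} {R C : Finset ℕ}
    (hR : R.card = k) (hC : C.card = k) :
    subDet F q n R C = (powMatrix F q n (R.orderEmbOfFin hR) C hC).det := by
  subst hR
  simp only [subDet, dif_pos hC]
  rfl

theorem exists_sign_subDet (F : Type) [Field F] (q n : ℕ) {k : ℕ} {R : Finset ℕ}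
    (hR : R.card = k) (e : Fin k → ℕ) (heR : ∀ i, e i ∈ R) (he : Function.Injective e) :
    ∃ ε : ℤˣ, ∀ (C : Finset ℕ) (hC : C.card = k),
      (powMatrix F q n e C hC).det = ((ε : ℤ) : SV F n) * subDet F q n R C := by
  have hsurj : ∀ i, ∃ i', R.orderEmbOfFin hR i' = e i := by
    intro i
    have : e i ∈ Set.range (R.orderEmbOfFin hR) := by
      rw [Finset.range_orderEmbOfFin]; exact heR i
    exact this
  choose σ hσ using hsurj
  have hinj : Function.Injective σ := fun i i' h => he (by rw [← hσ, ← hσ, h])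
  let π : Equiv.Perm (Fin k) := Equiv.ofBijective σ (Finite.injective_iff_bijective.mp hinj)
  refine ⟨Equiv.Perm.sign π, fun C hC => ?_⟩
  rw [subDet_eq_det_powMatrix F q n hR hC, ← Matrix.det_permute]
  congr 1
  ext1 i j
  simp [powMatrix, π, hσ]

theorem det_powMatrix_snoc (F : Type) [Field F] (q n : ℕ) {k : ℕ} (e : Fin k → ℕ) (b : ℕ)
    (T : Finset ℕ) (hT : T.card = k + 1) :
    (powMatrix F q n (Fin.snoc (α := fun _ => ℕ) e b) T hT).det
      = ∑ t : Fin (k + 1), xV F n (T.orderEmbOfFin hT t) ^ q ^ b * ((-1) ^ (k + (t : ℕ)) *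
          (Matrix.of fun i j : Fin k =>
            xV F n (T.orderEmbOfFin hT (t.succAbove j)) ^ q ^ e i).det) := by
  rw [Matrix.det_succ_row _ (Fin.last k)]
  refine Finset.sum_congr rfl fun t _ => ?_
  have : (powMatrix F q n (Fin.snoc (α := fun _ => ℕ) e b) T hT).submatrix
      (Fin.last k).succAbove t.succAbove
      = Matrix.of fun i j : Fin k => xV F n (T.orderEmbOfFin hT (t.succAbove j)) ^ q ^ e i := by
    ext1 i j
    simp [powMatrix]
  rw [this]
  simp [powMatrix]
  ring

theorem det_powMatrix_snoc_eq_zero (F : Type) [Field F] (q n : ℕ) {k : ℕ} (e : Fin k → ℕ)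
    (i : Fin k) (T : Finset ℕ) (hT : T.card = k + 1) :
    (powMatrix F q n (Fin.snoc (α := fun _ => ℕ) e (e i)) T hT).det = 0 := by
  refine Matrix.det_zero_of_row_eq (i := i.castSucc) (j := Fin.last k)
    (Fin.castSucc_lt_last i).ne ?_
  ext1 j
  simp [powMatrix]

/-- Linear dependence of the rows of a Moore-type matrix through the polynomial
`∑_b a_b X^{q^b}` vanishing at `x_1, …, x_m`. -/
theorem sum_mul_det_powMatrix_snoc {F : Type} [Field F] [Fintype F] {q n m k : ℕ} {a : ℕ → SV F n}
    (hP : ∀ Y, subspaceProd F n m Y = ∑ b ∈ range (m + 1), a b * Y ^ q ^ b)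
    (e : Fin k → ℕ) (T : Finset ℕ) (hT : T.card = k + 1) :
    ∑ b ∈ range (m + 1), a b * (powMatrix F q n (Fin.snoc (α := fun _ => ℕ) e b) T hT).det
      = ∑ t : Fin (k + 1), subspaceProd F n m (xV F n (T.orderEmbOfFin hT t)) *
          ((-1) ^ (k + (t : ℕ)) * (Matrix.of fun i j : Fin k =>
            xV F n (T.orderEmbOfFin hT (t.succAbove j)) ^ q ^ e i).det) := by
  simp only [det_powMatrix_snoc, hP, Finset.mul_sum, Finset.sum_mul]
  rw [Finset.sum_comm]
  simp only [mul_assoc]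

theorem sum_mul_det_powMatrix_snoc_of_lt {F : Type} [Field F] [Fintype F] {q n m k : ℕ}
    {a : ℕ → SV F n}
    (hP : ∀ Y, subspaceProd F n m Y = ∑ b ∈ range (m + 1), a b * Y ^ q ^ b)
    (e : Fin k → ℕ) (T : Finset ℕ) (hT : T.card = k + 1) (hTm : ∀ t ∈ T, t < m) :
    ∑ b ∈ range (m + 1), a b * (powMatrix F q n (Fin.snoc (α := fun _ => ℕ) e b) T hT).det = 0 := by
  rw [sum_mul_det_powMatrix_snoc hP]
  refine Finset.sum_eq_zero fun t _ => ?_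
  rw [subspaceProd_xV_eq_zero F n (hTm _ (Finset.orderEmbOfFin_mem _ _ _)), zero_mul]

theorem sum_mul_det_powMatrix_snoc_insert {F : Type} [Field F] [Fintype F] {q n m k : ℕ}
    {a : ℕ → SV F n}
    (hP : ∀ Y, subspaceProd F n m Y = ∑ b ∈ range (m + 1), a b * Y ^ q ^ b)
    (e : Fin k → ℕ) (C : Finset ℕ) (hC : C.card = k) (hCm : ∀ t ∈ C, t < m)
    (hT : (insert m C).card = k + 1) :
    ∑ b ∈ range (m + 1),
        a b * (powMatrix F q n (Fin.snoc (α := fun _ => ℕ) e b) (insert m C) hT).det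
      = linProd F n m m * (powMatrix F q n e C hC).det := by
  rw [sum_mul_det_powMatrix_snoc hP, Fin.sum_univ_castSucc, Finset.sum_eq_zero, zero_add]
  · rw [orderEmbOfFin_insert_last hC hCm, subspaceProd_xV, Fin.val_last, ← two_mul, pow_mul,
      neg_one_sq, one_pow, one_mul]
    simp only [Fin.succAbove_last, orderEmbOfFin_insert_castSucc hC hCm]
    rfl
  · intro t _
    rw [orderEmbOfFin_insert_castSucc hC hCm,
      subspaceProd_xV_eq_zero F n (hCm _ (Finset.orderEmbOfFin_mem _ _ _)), zero_mul]

theorem exists_subDet_expansion {F : Type} [Field F] [Fintype F] {q n m : ℕ}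
    {a : ℕ → SV F n} (ha : ∀ b, a b ∈ invS F n (Uset F n)) (ham : a m = 1)
    (hP : ∀ Y, subspaceProd F n m Y = ∑ b ∈ range (m + 1), a b * Y ^ q ^ b)
    {B : Finset ℕ} (hB : B ⊆ range m) :
    ∃ h : ℕ → SV F n, (∀ b, h b ∈ invS F n (Uset F n)) ∧
      ∀ S ∈ (range (m + 1)).powersetCard B.card,
        (if m ∈ S then 0 else linProd F n m m * subDet F q n (range m \ B) (range m \ S))
          = subDet F q n (range (m + 1) \ B) (range (m + 1) \ S) +
            ∑ b ∈ B, h b * subDet F q n (range (m + 1) \ insert m (B.erase b))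
              (range (m + 1) \ S) := by
  obtain ⟨k, hk⟩ : ∃ k, (range m \ B).card = k := ⟨_, rfl⟩
  have hkB : k + B.card = m := by
    rw [← hk, Finset.card_sdiff_add_card_eq_card hB, Finset.card_range]
  set e : Fin k → ℕ := ⇑((range m \ B).orderEmbOfFin hk) with he
  have hemem : ∀ i, e i ∈ range m \ B := fun i => Finset.orderEmbOfFin_mem _ _ _
  have heinj : Function.Injective e := ((range m \ B).orderEmbOfFin hk).injective
  have hsnoc : ∀ b ∉ range m \ B, ∃ ε : ℤˣ, ∀ (C : Finset ℕ) (hC : C.card = k + 1),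
      (powMatrix F q n (Fin.snoc (α := fun _ => ℕ) e b) C hC).det
        = ((ε : ℤ) : SV F n) * subDet F q n (insert b (range m \ B)) C := by
    intro b hb
    refine exists_sign_subDet F q n (by rw [Finset.card_insert_of_notMem hb, hk]) _ ?_ ?_
    · intro i
      refine Fin.lastCases (by simp) (fun i => ?_) i
      rw [Fin.snoc_castSucc]
      exact Finset.mem_insert_of_mem (hemem i)
    · rw [Fin.snoc_injective_iff]
      exact ⟨heinj, fun ⟨i, hi⟩ => hb (hi ▸ hemem i)⟩
  choose! ε hε using hsnoc
  refine ⟨fun b => a b * ((ε b : ℤ) : SV F n), fun b => mul_mem (ha b) (intCast_mem _ _),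
    fun S hS => ?_⟩
  rw [Finset.mem_powersetCard] at hS
  obtain ⟨hSm, hScard⟩ := hS
  have hT : (range (m + 1) \ S).card = k + 1 := by
    have := Finset.card_sdiff_add_card_eq_card hSm
    rw [Finset.card_range] at this
    omega
  have hmR : ∀ c ∈ range m \ B, c < m := fun c hc =>
    Finset.mem_range.mp (Finset.mem_sdiff.mp hc).1
  have hlast : (powMatrix F q n (Fin.snoc (α := fun _ => ℕ) e m) _ hT).det
      = subDet F q n (range (m + 1) \ B) (range (m + 1) \ S) := by
    have hset : range (m + 1) \ B = insert m (range m \ B) := by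
      rw [Finset.range_add_one, Finset.insert_sdiff_of_notMem]
      exact fun h => absurd (hB h) (by simp)
    have hcard : (insert m (range m \ B)).card = k + 1 := by
      rw [Finset.card_insert_of_notMem (by simp), hk]
    rw [hset, subDet_eq_det_powMatrix F q n hcard hT, orderEmbOfFin_insert_eq_snoc hk hmR]
  have hsum : ∑ b ∈ range (m + 1),
        a b * (powMatrix F q n (Fin.snoc (α := fun _ => ℕ) e b) _ hT).det
      = subDet F q n (range (m + 1) \ B) (range (m + 1) \ S) +
        ∑ b ∈ B, a b * ((ε b : ℤ) : SV F n) *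
          subDet F q n (range (m + 1) \ insert m (B.erase b)) (range (m + 1) \ S) := by
    rw [Finset.sum_range_succ, ham, one_mul, hlast, add_comm]
    congr 1
    rw [← Finset.sum_subset hB]
    · refine Finset.sum_congr rfl fun b hb => ?_
      have hbm := Finset.mem_range.mp (hB hb)
      have hset : range (m + 1) \ insert m (B.erase b) = insert b (range m \ B) := by
        ext x
        simp only [Finset.mem_sdiff, Finset.mem_range, Finset.mem_insert, Finset.mem_erase]
        by_cases hxb : x = b
        · subst hxb
          simp
          omega
        · simp only [hxb, ne_eq, not_false_eq_true, true_and, false_or, not_or]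
          constructor
          · rintro ⟨h1, h2, h3⟩
            exact ⟨by omega, h3⟩
          · rintro ⟨h1, h2⟩
            exact ⟨by omega, by omega, h2⟩
      rw [hset, hε b (by simp [hb]), mul_assoc]
    · intro b hb hbB
      have hbR : b ∈ Set.range e := by
        rw [he, Finset.range_orderEmbOfFin]
        exact Finset.mem_sdiff.mpr ⟨hb, hbB⟩
      obtain ⟨i, rfl⟩ := hbR
      rw [det_powMatrix_snoc_eq_zero, mul_zero]
  rw [← hsum]
  split_ifs with hmS
  · refine (sum_mul_det_powMatrix_snoc_of_lt hP e _ hT fun t ht => ?_).symm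
    rw [Finset.mem_sdiff, Finset.mem_range] at ht
    have : t ≠ m := fun h => ht.2 (h ▸ hmS)
    omega
  · have hset : range (m + 1) \ S = insert m (range m \ S) := by
      rw [Finset.range_add_one, Finset.insert_sdiff_of_notMem _ hmS]
    have hC : (range m \ S).card = k := by
      rw [hset, Finset.card_insert_of_notMem (by simp)] at hT
      omega
    have hCm : ∀ t ∈ range m \ S, t < m := fun t ht =>
      Finset.mem_range.mp (Finset.mem_sdiff.mp ht).1
    rw [subDet_eq_det_powMatrix F q n hk hC]
    clear hsum hlast
    generalize range (m + 1) \ S = T at hT hset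
    subst hset
    exact (sum_mul_det_powMatrix_snoc_insert hP e (range m \ S) hC hCm hT).symm

theorem exists_muiM_mul_linProd {F : Type} [Field F] [Fintype F] {p q r : ℕ} [ExpChar F p]
    (hq : q = p ^ r) (hF : Fintype.card F = q) {n m : ℕ} (hmn : m < n)
    {B : Finset ℕ} (hB : B ⊆ range m) :
    ∃ h : ℕ → SV F n, (∀ b, h b ∈ invS F n (Uset F n)) ∧
      linProd F n m m • MuiM F q n m B = MuiM F q n (m + 1) B +
        ∑ b ∈ B, h b • MuiM F q n (m + 1) (insert m (B.erase b)) := by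
  obtain ⟨a, ha, ham, hP⟩ := exists_linearized_coeff hq hF n m hmn.le
  obtain ⟨h, hh, hS⟩ := exists_subDet_expansion ha ham hP hB
  refine ⟨h, hh, ?_⟩
  have hcard : ∀ b ∈ B, (insert m (B.erase b)).card = B.card := by
    intro b hb
    rw [Finset.card_insert_of_notMem, Finset.card_erase_add_one hb]
    exact fun hm => absurd (hB (Finset.mem_of_mem_erase hm)) (by simp)
  have hR : ∑ b ∈ B, h b • MuiM F q n (m + 1) (insert m (B.erase b))
      = ∑ S ∈ (range (m + 1)).powersetCard B.card,
        ((-1 : F) ^ (B.card * (B.card + 1) / 2 + (∑ s ∈ S, s) + B.card)) •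
          ((∑ b ∈ B, h b * subDet F q n (range (m + 1) \ insert m (B.erase b))
            (range (m + 1) \ S)) ⊗ₜ[F] yProd F n S) := by
    simp only [TensorProduct.sum_tmul, Finset.smul_sum]
    rw [Finset.sum_comm]
    refine Finset.sum_congr rfl fun b hb => ?_
    rw [MuiM, hcard b hb, Finset.smul_sum]
    refine Finset.sum_congr rfl fun S _ => ?_
    rw [smul_comm, TensorProduct.smul_tmul', smul_eq_mul]
  have hL : linProd F n m m • MuiM F q n m B
      = ∑ S ∈ (range (m + 1)).powersetCard B.card,
        ((-1 : F) ^ (B.card * (B.card + 1) / 2 + (∑ s ∈ S, s) + B.card)) •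
          ((if m ∈ S then 0 else
            linProd F n m m * subDet F q n (range m \ B) (range m \ S)) ⊗ₜ[F] yProd F n S) := by
    rw [MuiM, Finset.smul_sum]
    rw [← Finset.sum_subset (Finset.powersetCard_mono
      (Finset.range_subset_range.mpr (Nat.le_succ m)))]
    · refine Finset.sum_congr rfl fun S hS => ?_
      have hmS : m ∉ S := fun hm =>
        absurd ((Finset.mem_powersetCard.mp hS).1 hm) (by simp)
      rw [if_neg hmS, smul_comm, TensorProduct.smul_tmul', smul_eq_mul]
    · intro S hS hS'
      have hmS : m ∈ S := by
        by_contra hmS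
        rw [Finset.mem_powersetCard] at hS hS'
        refine hS' ⟨fun s hs => ?_, hS.2⟩
        have h1 := Finset.mem_range.mp (hS.1 hs)
        have h2 : s ≠ m := fun h => hmS (h ▸ hs)
        rw [Finset.mem_range]
        omega
      rw [if_pos hmS, TensorProduct.zero_tmul, smul_zero]
  rw [hL, hR, MuiM, ← Finset.sum_add_distrib]
  refine Finset.sum_congr rfl fun S hSmem => ?_
  rw [hS S hSmem, TensorProduct.add_tmul, smul_add]

/-- The span over the `U_n`-invariants of the `M_{k;C}` with `C ⊆ {0,…,k-1}`, `|C| = j` and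
`max C ≥ m`. -/
def higherSpan (F : Type) [Field F] (q n m j k : ℕ) :
    Submodule (invS F n (Uset F n)) (SL F n) :=
  Submodule.span _ {z | ∃ C ⊆ range k, C.card = j ∧ (∃ c ∈ C, m ≤ c) ∧ z = MuiM F q n k C}

theorem linProd_smul_muiM_sub_mem {F : Type} [Field F] [Fintype F] {p q r : ℕ} [ExpChar F p]
    (hq : q = p ^ r) (hF : Fintype.card F = q) {n m k : ℕ} (hmk : m ≤ k) (hkn : k < n)
    {B : Finset ℕ} (hB : B ⊆ range k) :
    linProd F n k k • MuiM F q n k B - MuiM F q n (k + 1) B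
      ∈ higherSpan F q n m B.card (k + 1) := by
  obtain ⟨h, hh, heq⟩ := exists_muiM_mul_linProd hq hF hkn hB
  rw [heq, add_sub_cancel_left]
  refine Submodule.sum_mem _ fun b hb => ?_
  refine Submodule.smul_mem _ (⟨h b, hh b⟩ : invS F n (Uset F n)) (Submodule.subset_span ?_)
  refine ⟨_, ?_, ?_, ⟨k, Finset.mem_insert_self _ _, hmk⟩, rfl⟩
  · rw [Finset.range_add_one]
    exact Finset.insert_subset_insert _ ((Finset.erase_subset _ _).trans hB)
  · rw [Finset.card_insert_of_notMem, Finset.card_erase_add_one hb]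
    exact fun hm => absurd (hB (Finset.mem_of_mem_erase hm)) (by simp)

theorem linProd_smul_mem_higherSpan {F : Type} [Field F] [Fintype F] {p q r : ℕ} [ExpChar F p]
    (hq : q = p ^ r) (hF : Fintype.card F = q) {n m j k : ℕ} (hmk : m ≤ k) (hkn : k < n)
    {z : SL F n} (hz : z ∈ higherSpan F q n m j k) :
    linProd F n k k • z ∈ higherSpan F q n m j (k + 1) := by
  induction hz using Submodule.span_induction with
  | mem z hz =>
    obtain ⟨C, hCk, hC, hCm, rfl⟩ := hz
    have hsub : MuiM F q n (k + 1) C ∈ higherSpan F q n m j (k + 1) :=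
      Submodule.subset_span
        ⟨C, hCk.trans (Finset.range_subset_range.mpr (Nat.le_succ k)), hC, hCm, rfl⟩
    have := add_mem (hC ▸ linProd_smul_muiM_sub_mem hq hF hmk hkn hCk) hsub
    rwa [sub_add_cancel] at this
  | zero => rw [smul_zero]; exact zero_mem _
  | add x y _ _ hx hy => rw [smul_add]; exact add_mem hx hy
  | smul a x _ hx =>
    have : linProd F n k k • a • x = a • linProd F n k k • x := smul_comm _ (a : SV F n) x
    rw [this]
    exact Submodule.smul_mem _ _ hx

theorem prod_linProd_smul_muiM_sub_mem {F : Type} [Field F] [Fintype F] {p q r : ℕ} [ExpChar F p]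
    (hq : q = p ^ r) (hF : Fintype.card F = q) {n m k : ℕ} (hmk : m ≤ k) (hkn : k ≤ n)
    {B : Finset ℕ} (hB : B ⊆ range m) :
    (∏ a ∈ Finset.Ico m k, linProd F n a a) • MuiM F q n m B - MuiM F q n k B
      ∈ higherSpan F q n m B.card k := by
  induction k, hmk using Nat.le_induction with
  | base => simp
  | succ k hmk ih =>
    have h1 := linProd_smul_mem_higherSpan hq hF hmk hkn (ih (by omega))
    have h2 := linProd_smul_muiM_sub_mem hq hF hmk hkn
      (hB.trans (Finset.range_subset_range.mpr hmk))
    have := add_mem h1 h2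
    rwa [smul_sub, sub_add_sub_cancel, smul_smul, mul_comm, ← Finset.prod_Ico_succ_top hmk] at this

/-- **Lemma 2.3** (Mui, Lemma 5.1). For `1 ≤ j ≤ m ≤ n` and
`0 ≤ b_1 < ⋯ < b_j ≤ m−1` there exist `U_n(q)`-invariant polynomials
`h_{c_1,…,c_j}` such that
`M_{m;b_1,…,b_j} V_{m+1} ⋯ V_n = M_{n;b_1,…,b_j} + ∑ M_{n;c_1,…,c_j} h_{c_1,…,c_j}`,
the sum over sequences `(c_1,…,c_j) > (b_j−j+1, …, b_j)`. -/
theorem mui_stabilization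
    (F : Type) [Field F] [Fintype F] (p r q n m j : ℕ)
    (hp : p.Prime) (hr : 0 < r) (hq : q = p ^ r) (hF : Fintype.card F = q)
    (hj : 1 ≤ j) (hjm : j ≤ m) (hmn : m ≤ n)
    (b : Fin j → ℕ) (hb : StrictMono b) (hbm : ∀ i, b i < m) :
    ∃ h : (Fin j → Fin n) → SV F n,
      (∀ c, h c ∈ invS F n (Uset F n)) ∧
      MuiM F q n m (Finset.image b Finset.univ) *
          ((∏ a ∈ Finset.Ico m n, linProd F n a a) ⊗ₜ[F] (1 : LV F n))
        = MuiM F q n n (Finset.image b Finset.univ)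
          + ∑ c ∈ Finset.univ.filter (fun c : Fin j → Fin n =>
              (∀ a a' : Fin j, a < a' → c a < c a') ∧
              ∃ k : Fin j,
                (b ⟨j - 1, by omega⟩ + 1 + (k : ℕ) - j < (c k : ℕ) ∧
                 ∀ i : Fin j, k < i →
                   (c i : ℕ) = b ⟨j - 1, by omega⟩ + 1 + (i : ℕ) - j)),
              MuiM F q n n (Finset.image (fun i => (c i : ℕ)) Finset.univ) *
                (h c ⊗ₜ[F] (1 : LV F n)) := by
  have : Fact p.Prime := ⟨hp⟩
  have : CharP F p := charP_of_card_eq_prime_pow (hF.trans hq)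
  have hcardB : (Finset.image b Finset.univ).card = j := by
    rw [Finset.card_image_of_injective _ hb.injective, Finset.card_univ, Fintype.card_fin]
  have hB : Finset.image b Finset.univ ⊆ range m := by
    intro x hx
    obtain ⟨i, -, rfl⟩ := Finset.mem_image.mp hx
    exact Finset.mem_range.mpr (hbm i)
  have hmem := prod_linProd_smul_muiM_sub_mem hq hF hmn le_rfl hB
  rw [hcardB] at hmem
  set I := Finset.univ.filter (fun c : Fin j → Fin n =>
    (∀ a a' : Fin j, a < a' → c a < c a') ∧
      ∃ k : Fin j, (b ⟨j - 1, by omega⟩ + 1 + (k : ℕ) - j < (c k : ℕ) ∧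
        ∀ i : Fin j, k < i → (c i : ℕ) = b ⟨j - 1, by omega⟩ + 1 + (i : ℕ) - j)) with hI
  have hle : higherSpan F q n m j n ≤ Submodule.span (invS F n (Uset F n)) (Set.range
      fun c : I => MuiM F q n n (Finset.image (fun i => (c.1 i : ℕ)) Finset.univ)) := by
    refine Submodule.span_mono ?_
    rintro z ⟨C, hCn, hC, ⟨t, htC, hmt⟩, rfl⟩
    have hlt : ∀ i, C.orderEmbOfFin hC i < n := fun i =>
      Finset.mem_range.mp (hCn (Finset.orderEmbOfFin_mem C hC i))
    refine ⟨⟨fun i => ⟨C.orderEmbOfFin hC i, hlt i⟩, ?_⟩, ?_⟩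
    · rw [hI, Finset.mem_filter]
      refine ⟨Finset.mem_univ _, fun i i' hii' => ?_, ⟨j - 1, by omega⟩, ?_, fun i hi => ?_⟩
      · exact (C.orderEmbOfFin hC).strictMono hii'
      · obtain ⟨i, hi⟩ : t ∈ Set.range (C.orderEmbOfFin hC) := by
          rw [Finset.range_orderEmbOfFin]; exact htC
        have h1 : C.orderEmbOfFin hC i ≤ C.orderEmbOfFin hC ⟨j - 1, by omega⟩ :=
          (C.orderEmbOfFin hC).monotone (Fin.le_def.mpr (by have := i.2; simp only; omega))
        have h2 := hbm ⟨j - 1, by omega⟩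
        simp only
        omega
      · have h1 := i.2
        have h2 := Fin.lt_def.mp hi
        simp only at h2
        omega
    · exact congrArg (MuiM F q n n) (Finset.image_orderEmbOfFin_univ C hC)
  obtain ⟨g, hg⟩ := (Submodule.mem_span_range_iff_exists_fun _).mp (hle hmem)
  have hsmul : ∀ (f : SV F n) (z : SL F n), z * (f ⊗ₜ[F] (1 : LV F n)) = f • z := by
    intro f z
    induction z using TensorProduct.induction_on with
    | zero => rw [zero_mul, smul_zero]
    | tmul s l =>
      rw [Algebra.TensorProduct.tmul_mul_tmul, mul_one, TensorProduct.smul_tmul', smul_eq_mul,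
        mul_comm]
    | add x y hx hy => rw [add_mul, smul_add, hx, hy]
  refine ⟨fun c => if hc : c ∈ I then g ⟨c, hc⟩ else 0, fun c => ?_, ?_⟩
  · dsimp only
    split_ifs
    · exact (g _).2
    · exact zero_mem _
  · rw [hsmul, ← sub_eq_iff_eq_add', ← hg, ← Finset.sum_coe_sort I]
    refine Finset.sum_congr rfl fun c _ => ?_
    rw [hsmul]
    dsimp only
    rw [dif_pos c.2]
    rfl
end
end
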